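/- arXiv:2410.21460 — 2 statements merged into one kernel-verified Lean document; each statement's English description precedes it below -/
import Mathlib

section
/- Let (xₙ) be a sequence of points in ℝ² converging to a point x. Then there exist a simple closed C¹ curve Γ in ℝ² and a strictly increasing sequence of indices (n_k) such that x_{n_k} ∈ Γ for all k. -/
open Filter Topology

noncomputable section

abbrev Plane : Type := ℝ × ℝ

abbrev ProjLine : Type := Projectivization ℝ Plane

instance : TopologicalSpace ProjLine := instTopologicalSpaceQuotient

/-- A regular (C¹, 1-periodic, injective on `[0,1)`, nowhere-vanishing derivative)
parameterization of a simple closed C¹ curve. -/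
def IsRegParam (γ : ℝ → Plane) : Prop :=
  ContDiff ℝ 1 γ ∧ Function.Periodic γ 1 ∧ Set.InjOn γ (Set.Ico 0 1) ∧ ∀ t, deriv γ t ≠ 0

/-- `Γ` is a simple closed C¹ curve. -/
def IsC1Curve (Γ : Set Plane) : Prop := ∃ γ : ℝ → Plane, IsRegParam γ ∧ Γ = Set.range γ

/-- `Γ` is a simple closed C¹ curve through `p` with tangent line `ℓ` at `p`. -/
def TangentAt (Γ : Set Plane) (p : Plane) (ℓ : ProjLine) : Prop :=
  ∃ (γ : ℝ → Plane) (t₀ : ℝ) (h : IsRegParam γ),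
    Γ = Set.range γ ∧ γ t₀ = p ∧ ℓ = Projectivization.mk ℝ (deriv γ t₀) (h.2.2.2 t₀)

/-- `f` maps every simple closed C¹ curve to a simple closed C¹ curve. -/
def MapsC1 (f : Plane → Plane) : Prop := ∀ Γ : Set Plane, IsC1Curve Γ → IsC1Curve (f '' Γ)

/-- Membership in `Homeo¹(ℝ²)`. -/
def InHomeo1 (f : Plane ≃ₜ Plane) : Prop := MapsC1 ⇑f ∧ MapsC1 ⇑f.symm

/-- `φ` is a homeomorphism of projective tangent spaces induced by `f` at `p`. -/
def InducesAt (f : Plane → Plane) (p : Plane) (φ : ProjLine ≃ₜ ProjLine) : Prop :=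
  ∀ (Γ : Set Plane) (ℓ : ProjLine), TangentAt Γ p ℓ →
    IsC1Curve (f '' Γ) ∧ TangentAt (f '' Γ) (f p) (φ ℓ)

/-- The secant direction from `q` to `x` (junk value if `x = q`). -/
def secantDir (q x : Plane) : ProjLine :=
  if h : x = q then Projectivization.mk ℝ (1, 0) (by simp) else
    Projectivization.mk ℝ (x - q) (sub_ne_zero.mpr h)

/-- The sequence `x` converges along the line `ℓ` to `p`. -/
def ConvAlong (p : Plane) (ℓ : ProjLine) (x : ℕ → Plane) : Prop :=
  (∀ n, x n ≠ p) ∧ Tendsto x atTop (𝓝 p) ∧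
    Tendsto (fun n => secantDir p (x n)) atTop (𝓝 ℓ)

/-- `(x, k)` is a transverse sequence for `(p, ℓ)`. -/
def TransverseFor (p : Plane) (ℓ : ProjLine) (x : ℕ → Plane) (k : ℕ → ProjLine) : Prop :=
  ConvAlong p ℓ x ∧
    ∀ φ : ℕ → ℕ, StrictMono φ →
      ¬ Tendsto (fun n => (x (φ n), k (φ n))) atTop (𝓝 (p, ℓ))

/-- `(x, k)` is a transverse sequence. -/
def Transverse (x : ℕ → Plane) (k : ℕ → ProjLine) : Prop := ∃ p ℓ, TransverseFor p ℓ x k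

/-- A C¹ function interpolating rapidly decreasing values `g k = o(s k)` at lacunary
nodes `s k`. -/
theorem exists_contDiff_interpolation (s g : ℕ → ℝ) (hs : ∀ k, s k ≠ 0) (hs1 : ∀ k, |s k| ≤ 1)
    (hg : ∀ k, |g k| ≤ (1 / 2) ^ k * |s k|) (hlac : ∀ j k, j < k → 2 * |s k| ≤ |s j|) :
    ∃ h : ℝ → ℝ, ContDiff ℝ 1 h ∧ ∀ k, h (s k) = g k := by
  let ψ : ContDiffBump (0 : ℝ) := ⟨1 / 4, 1 / 2, by norm_num, by norm_num⟩
  have hψ : ContDiff ℝ 1 (ψ : ℝ → ℝ) := ψ.contDiff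
  obtain ⟨C, hC⟩ := (hψ.continuous_deriv le_rfl).bounded_above_of_compact_support
    ψ.hasCompactSupport.deriv
  let f : ℕ → ℝ → ℝ := fun k t => g k * ψ (|s k|⁻¹ * (t - s k))
  have hpos : ∀ k, 0 < |s k| := fun k => abs_pos.mpr (hs k)
  have hf : ∀ k, ContDiff ℝ 1 (f k) := fun k =>
    contDiff_const.mul (hψ.comp (contDiff_const.mul (contDiff_id.sub contDiff_const)))
  have hderiv : ∀ k t, HasDerivAt (f k)
      (g k * (deriv ψ (|s k|⁻¹ * (t - s k)) * |s k|⁻¹)) t := by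
    intro k t
    have h1 : HasDerivAt (fun t => |s k|⁻¹ * (t - s k)) (|s k|⁻¹) t := by
      simpa using ((hasDerivAt_id t).sub_const (s k)).const_mul (|s k|⁻¹)
    have h2 := (hψ.differentiable one_ne_zero (|s k|⁻¹ * (t - s k))).hasDerivAt
    exact (h2.comp t h1).const_mul (g k)
  have hgeo : Summable fun k : ℕ => (1 / 2 : ℝ) ^ k := summable_geometric_two
  refine ⟨fun t => ∑' k, f k t, ?_, ?_⟩
  · refine contDiff_tsum (v := fun m k => if m = 0 then (1 / 2 : ℝ) ^ k else (1 / 2) ^ k * C)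
      hf ?_ ?_
    · intro m _
      by_cases hm : m = 0
      · simpa [hm] using hgeo
      · simpa [hm] using hgeo.mul_right C
    · intro m k t hm
      have hm1 : m ≤ 1 := by exact_mod_cast hm
      rw [norm_iteratedFDeriv_eq_norm_iteratedDeriv]
      interval_cases m
      · simp only [iteratedDeriv_zero, if_true, f, norm_mul, Real.norm_eq_abs]
        have h1 : |ψ (|s k|⁻¹ * (t - s k))| ≤ 1 := by
          rw [abs_of_nonneg ψ.nonneg]; exact ψ.le_one
        calc _ ≤ |g k| * 1 := by gcongr
          _ ≤ (1 / 2) ^ k * |s k| := by rw [mul_one]; exact hg k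
          _ ≤ (1 / 2) ^ k * 1 := by gcongr; exact hs1 k
          _ = _ := mul_one _
      · rw [iteratedDeriv_one, (hderiv k t).deriv]
        simp only [one_ne_zero, if_false, norm_mul]
        have hC0 : 0 ≤ C := (norm_nonneg _).trans (hC 0)
        calc _ ≤ ((1 / 2) ^ k * |s k|) * (C * ‖|s k|⁻¹‖) := by
              gcongr
              · exact hg k
              · exact hC _
          _ = (1 / 2) ^ k * C := by
              rw [Real.norm_of_nonneg (inv_nonneg.mpr (hpos k).le)]
              field_simp [(hpos k).ne']
  · intro k
    have hself : f k (s k) = g k := by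
      have : ψ (0 : ℝ) = 1 := ψ.one_of_mem_closedBall (by simp [ψ])
      simp [f, this]
    refine (tsum_eq_single k ?_).trans hself
    intro j hj
    have hdist : |s j| / 2 ≤ |s k - s j| := by
      rcases lt_or_gt_of_ne hj with h | h
      · have h1 := hlac j k h
        have h2 := abs_sub_abs_le_abs_sub (s j) (s k)
        rw [abs_sub_comm] at h2
        linarith
      · have h1 := hlac k j h
        have h2 := abs_sub_abs_le_abs_sub (s k) (s j)
        linarith [hpos j]
    have : ψ (|s j|⁻¹ * (s k - s j)) = 0 := by
      apply ψ.zero_of_le_dist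
      rw [dist_zero_right, norm_mul, norm_inv, Real.norm_eq_abs, Real.norm_eq_abs, abs_abs]
      rw [← div_eq_inv_mul, le_div_iff₀ (hpos j)]
      change 1 / 2 * |s j| ≤ _
      linarith
    simp [f, this]

/-- Sequences with `s n → 0` and `g n = o(s n)` can be interpolated by a C¹ function along a
subsequence. -/
theorem exists_subseq_contDiff_interpolation (s g : ℕ → ℝ) (hs : ∀ᶠ n in atTop, s n ≠ 0)
    (hs0 : Tendsto s atTop (𝓝 0)) (hg : Tendsto (fun n => g n / s n) atTop (𝓝 0)) :
    ∃ (φ : ℕ → ℕ) (h : ℝ → ℝ), StrictMono φ ∧ ContDiff ℝ 1 h ∧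
      ∀ k, s (φ k) ≠ 0 ∧ h (s (φ k)) = g (φ k) := by
  obtain ⟨φ, hφ, hP⟩ := extraction_forall_of_eventually
    (P := fun k n => s n ≠ 0 ∧ |s n| ≤ 1 ∧ |g n| ≤ (1 / 2) ^ k * |s n|) (by
      intro k
      have h1 : ∀ᶠ n in atTop, |s n| < 1 := by
        simpa using hs0.abs.eventually_lt_const (by norm_num : |(0 : ℝ)| < 1)
      have h2 : ∀ᶠ n in atTop, |g n / s n| < (1 / 2) ^ k :=
        hg.abs.eventually_lt_const (by rw [abs_zero]; positivity)
      filter_upwards [hs, h1, h2] with n h0 h1 h2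
      refine ⟨h0, h1.le, ?_⟩
      rw [abs_div, div_lt_iff₀ (abs_pos.mpr h0)] at h2
      exact h2.le)
  obtain ⟨θ, hθ⟩ := exists_seq_of_forall_finset_exists (fun _ : ℕ => True)
    (fun m n => m < n ∧ 2 * |s (φ n)| ≤ |s (φ m)|) (by
      intro F _
      have : ∀ᶠ n in atTop, ∀ m ∈ F, m < n ∧ 2 * |s (φ n)| ≤ |s (φ m)| := by
        rw [Filter.eventually_all_finset]
        intro m _
        have h1 : Tendsto (fun n => 2 * |s (φ n)|) atTop (𝓝 0) := by
          simpa using (hs0.comp hφ.tendsto_atTop).abs.const_mul 2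
        filter_upwards [eventually_gt_atTop m,
          h1.eventually_lt_const (abs_pos.mpr (hP m).1)] with n a b
        exact ⟨a, b.le⟩
      obtain ⟨n, hn⟩ := this.exists
      exact ⟨n, trivial, hn⟩)
  have hθm : StrictMono θ := fun m n h => (hθ.2 m n h).1
  obtain ⟨h, hh, hv⟩ := exists_contDiff_interpolation (fun k => s (φ (θ k)))
    (fun k => g (φ (θ k))) (fun k => (hP _).1) (fun k => (hP _).2.1)
    (fun k => (hP (θ k)).2.2.trans (by
      have := pow_le_pow_of_le_one (by norm_num : (0 : ℝ) ≤ 1 / 2) (by norm_num)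
        (hθm.le_apply (x := k))
      gcongr))
    (fun j k hjk => (hθ.2 j k hjk).2)
  exact ⟨φ ∘ θ, h, hφ.comp hθm, hh, fun k => ⟨(hP (θ k)).1, hv k⟩⟩

/-- The curve `exp (h (sin θ) + θ i)`, moved by a complex affine map, is a simple closed
C¹ curve. -/
theorem isRegParam_exp (h : ℝ → ℝ) (hh : ContDiff ℝ 1 h) (a b : ℂ) (ha : a ≠ 0) :
    IsRegParam fun t : ℝ => Complex.equivRealProdCLM
      (a * Complex.exp (h (Real.sin (2 * Real.pi * t)) + (2 * Real.pi * t : ℝ) * Complex.I) + b) := by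
  have hlin : ContDiff ℝ 1 fun t : ℝ => 2 * Real.pi * t := contDiff_const.mul contDiff_id
  have hu : ContDiff ℝ 1 fun t : ℝ => h (Real.sin (2 * Real.pi * t)) :=
    hh.comp (Real.contDiff_sin.comp hlin)
  have hE : ContDiff ℝ 1 fun t : ℝ =>
      (h (Real.sin (2 * Real.pi * t)) + (2 * Real.pi * t : ℝ) * Complex.I : ℂ) :=
    (Complex.ofRealCLM.contDiff.comp hu).add
      ((Complex.ofRealCLM.contDiff.comp hlin).mul contDiff_const)
  refine ⟨?_, ?_, ?_, ?_⟩
  · exact Complex.equivRealProdCLM.contDiff.comp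
      ((contDiff_const.mul hE.cexp).add contDiff_const)
  · intro t
    have h1 : 2 * Real.pi * (t + 1) = 2 * Real.pi * t + 2 * Real.pi := by ring
    have h2 : ((h (Real.sin (2 * Real.pi * t)) : ℂ)
        + ((2 * Real.pi * t + 2 * Real.pi : ℝ) : ℂ) * Complex.I)
        = (h (Real.sin (2 * Real.pi * t)) + (2 * Real.pi * t : ℝ) * Complex.I)
          + 2 * Real.pi * Complex.I := by push_cast; ring
    simp only [h1, Real.sin_add_two_pi]
    rw [h2, Complex.exp_periodic]
  · intro t ht t' ht' heq
    have h1 := mul_left_cancel₀ ha (add_right_cancel (Complex.equivRealProdCLM.injective heq))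
    obtain ⟨n, hn⟩ := Complex.exp_eq_exp_iff_exists_int.mp h1
    have h2 : 2 * Real.pi * t = 2 * Real.pi * t' + n * (2 * Real.pi) := by
      simpa using congrArg Complex.im hn
    have h3 : t = t' + n := by
      apply mul_left_cancel₀ Real.two_pi_pos.ne'
      linarith
    have h4 : -1 < (n : ℝ) := by linarith [ht.1, ht'.2]
    have h5 : (n : ℝ) < 1 := by linarith [ht.2, ht'.1]
    have h6 : n = 0 := by
      have : -1 < n := by exact_mod_cast h4
      have : n < 1 := by exact_mod_cast h5
      omega
    simpa [h6] using h3
  · intro t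
    have hu' := (hu.differentiable one_ne_zero t).hasDerivAt
    have hl' : HasDerivAt (fun t : ℝ => 2 * Real.pi * t) (2 * Real.pi) t := by
      simpa using (hasDerivAt_id t).const_mul (2 * Real.pi)
    have hγ := (((((hu'.ofReal_comp).add
      (hl'.ofReal_comp.mul_const Complex.I)).cexp).const_mul a).add_const b)
    have hγ' := Complex.equivRealProdCLM.hasFDerivAt.comp_hasDerivAt t hγ
    have hd := hγ'.deriv
    intro h0
    have h1 := hd.symm.trans h0
    have h2 := Complex.equivRealProdCLM.injective (h1.trans (map_zero _).symm)
    have h3 := (mul_eq_zero.mp ((mul_eq_zero.mp h2).resolve_left ha)).resolve_left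
      (Complex.exp_ne_zero _)
    have h4 : 2 * Real.pi = 0 := by simpa using congrArg Complex.im h3
    exact Real.two_pi_pos.ne' h4

/-- If `d n → 0` in the direction `i`, then `log ‖1 + d n‖` is negligible compared to
`sin (arg (1 + d n))`. -/
theorem tendsto_log_norm_div_sin_arg (d : ℕ → ℂ) (hd : ∀ n, d n ≠ 0)
    (hd0 : Tendsto d atTop (𝓝 0))
    (hdir : Tendsto (fun n => d n / ‖d n‖) atTop (𝓝 Complex.I)) :
    Tendsto (fun n => Real.log ‖1 + d n‖ / Real.sin (Complex.arg (1 + d n))) atTop (𝓝 0) ∧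
      ∀ᶠ n in atTop, Real.sin (Complex.arg (1 + d n)) ≠ 0 := by
  have hpos : ∀ n, 0 < ‖d n‖ := fun n => norm_pos_iff.mpr (hd n)
  have hnorm : Tendsto (fun n => ‖1 + d n‖) atTop (𝓝 1) := by
    simpa using (hd0.const_add 1).norm
  have him : Tendsto (fun n => (d n).im / ‖d n‖) atTop (𝓝 1) := by
    simpa [Function.comp_def] using (Complex.continuous_im.tendsto _).comp hdir
  have hslope : Tendsto (fun n => Complex.log (1 + d n) / d n) atTop (𝓝 1) := by
    have h1 : HasDerivAt Complex.log 1 1 := by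
      simpa using Complex.hasDerivAt_log Complex.one_mem_slitPlane
    have h2 := h1.tendsto_slope_zero
    have h3 : Tendsto d atTop (𝓝[≠] 0) :=
      tendsto_nhdsWithin_iff.mpr ⟨hd0, Eventually.of_forall hd⟩
    simpa [Function.comp_def, div_eq_inv_mul] using h2.comp h3
  have hlog : Tendsto (fun n => Real.log ‖1 + d n‖ / ‖d n‖) atTop (𝓝 0) := by
    have h1 : Tendsto (fun n => (Complex.log (1 + d n) / ‖d n‖).re) atTop (𝓝 0) := by
      have h2 := (Complex.continuous_re.tendsto _).comp (hslope.mul hdir)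
      simp only [one_mul, Complex.I_re] at h2
      refine h2.congr fun n => ?_
      simp only [Function.comp_apply]
      rw [div_mul_div_cancel₀ (hd n)]
    simpa [Complex.log_re] using h1
  have him0 : ∀ᶠ n in atTop, (d n).im / ‖d n‖ ≠ 0 := him.eventually_ne one_ne_zero
  have hnorm0 : ∀ᶠ n in atTop, ‖1 + d n‖ ≠ 0 := hnorm.eventually_ne one_ne_zero
  have hsin : ∀ n, Real.sin (Complex.arg (1 + d n)) = (d n).im / ‖1 + d n‖ := fun n => by
    simp [Complex.sin_arg]
  constructor
  · have h1 : Tendsto (fun n => ‖1 + d n‖ * ((Real.log ‖1 + d n‖ / ‖d n‖)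
        / ((d n).im / ‖d n‖))) atTop (𝓝 0) := by
      simpa using hnorm.mul (hlog.div him one_ne_zero)
    refine h1.congr fun n => ?_
    rw [hsin, div_div_div_cancel_right₀ (hpos n).ne', div_div_eq_mul_div]
    ring
  · filter_upwards [him0, hnorm0] with n h1 h2
    rw [hsin]
    exact div_ne_zero (fun h => h1 (by simp [h])) h2

/-- A circle through a given point. -/
theorem exists_isC1Curve_mem (p : Plane) : ∃ Γ, IsC1Curve Γ ∧ p ∈ Γ := by
  refine ⟨_, ⟨_, isRegParam_exp (fun _ => 0) contDiff_const 1
    (Complex.equivRealProdCLM.symm p - 1) one_ne_zero, rfl⟩, 0, ?_⟩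
  simp

/-- Through any convergent sequence of points in the plane there is a simple closed C¹
curve passing through infinitely many of the points. -/
theorem c1_curve_through_subsequence (x : ℕ → Plane) (p : Plane)
    (hx : Tendsto x atTop (𝓝 p)) :
    ∃ (Γ : Set Plane) (φ : ℕ → ℕ), IsC1Curve Γ ∧ StrictMono φ ∧ ∀ k : ℕ, x (φ k) ∈ Γ := by
  by_cases hp : ∃ᶠ n in atTop, x n = p
  · obtain ⟨φ, hφ, hval⟩ := extraction_of_frequently_atTop hp
    obtain ⟨Γ, hΓ, hmem⟩ := exists_isC1Curve_mem p
    exact ⟨Γ, φ, hΓ, hφ, fun k => by rw [hval k]; exact hmem⟩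
  rw [not_frequently] at hp
  obtain ⟨φ₁, hφ₁, hne⟩ := extraction_of_eventually_atTop hp
  let L := Complex.equivRealProdCLM
  let e : ℕ → ℂ := fun n => L.symm (x (φ₁ n) - p)
  have he : ∀ n, e n ≠ 0 := fun n h =>
    hne n (sub_eq_zero.mp (L.symm.injective (h.trans (map_zero _).symm)))
  have he0 : Tendsto e atTop (𝓝 0) := by
    have h1 := (hx.comp hφ₁.tendsto_atTop).sub_const p
    rw [sub_self] at h1
    have h2 := (L.symm.continuous.tendsto 0).comp h1
    rwa [map_zero] at h2
  obtain ⟨u, hu, φ₂, hφ₂, hlim⟩ := (isCompact_sphere (0 : ℂ) 1).tendsto_subseq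
    (x := fun n => e n / ‖e n‖) (fun n => by simp [he n])
  have hu1 : ‖u‖ = 1 := by simpa using hu
  have hu0 : u ≠ 0 := fun h => by simp [h] at hu1
  let a : ℂ := u / Complex.I
  have ha : a ≠ 0 := div_ne_zero hu0 Complex.I_ne_zero
  have ha1 : ‖a‖ = 1 := by simp [a, hu1]
  let d : ℕ → ℂ := fun n => e (φ₂ n) / a
  have hd : ∀ n, d n ≠ 0 := fun n => div_ne_zero (he _) ha
  have hd0 : Tendsto d atTop (𝓝 0) := by
    simpa using (he0.comp hφ₂.tendsto_atTop).div_const a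
  have hdir : Tendsto (fun n => d n / ‖d n‖) atTop (𝓝 Complex.I) := by
    have h1 := hlim.div_const a
    have h2 : u / a = Complex.I := by simp only [a]; field_simp
    rw [h2] at h1
    refine h1.congr fun n => ?_
    simp only [d, Function.comp_apply, norm_div, ha1, div_one]
    ring
  obtain ⟨hquot, hsin⟩ := tendsto_log_norm_div_sin_arg d hd hd0 hdir
  have hz : Tendsto (fun n => 1 + d n) atTop (𝓝 1) := by simpa using hd0.const_add 1
  have hs0 : Tendsto (fun n => Real.sin (Complex.arg (1 + d n))) atTop (𝓝 0) := by
    have h1 := (Complex.continuousAt_arg Complex.one_mem_slitPlane).tendsto.comp hz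
    simpa [Function.comp_def] using (Real.continuous_sin.tendsto _).comp h1
  obtain ⟨φ₃, h, hφ₃, hh, hval⟩ := exists_subseq_contDiff_interpolation _ _ hsin hs0 hquot
  refine ⟨_, φ₁ ∘ φ₂ ∘ φ₃, ⟨_, isRegParam_exp h hh a (L.symm p - a) ha, rfl⟩,
    hφ₁.comp (hφ₂.comp hφ₃), fun k => ⟨Complex.arg (1 + d (φ₃ k)) / (2 * Real.pi), ?_⟩⟩
  have h0 : 1 + d (φ₃ k) ≠ 0 := fun hz0 =>
    (hval k).1 (by simp [hz0])
  have h1 : 2 * Real.pi * (Complex.arg (1 + d (φ₃ k)) / (2 * Real.pi))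
      = Complex.arg (1 + d (φ₃ k)) := mul_div_cancel₀ _ Real.two_pi_pos.ne'
  have h2 : a * (1 + d (φ₃ k)) + (L.symm p - a) = L.symm (x (φ₁ (φ₂ (φ₃ k)))) := by
    have : a * d (φ₃ k) = L.symm (x (φ₁ (φ₂ (φ₃ k))) - p) := mul_div_cancel₀ _ ha
    rw [mul_add, this, map_sub]
    ring
  simp only [h1, (hval k).2]
  rw [← Complex.log, Complex.exp_log h0, h2]
  exact L.apply_symm_apply _
end
end

section
/- Let f ∈ Homeo¹(ℝ²), and for each q ∈ ℝ² let φ_q : ℙ(ℝ²) → ℙ(ℝ²) be a homeomorphism induced by f at q (such maps exist and are unique). If (pₙ, ℓₙ) is a transverse sequence for (p, ℓ), then ((f(pₙ), φ_{pₙ}(ℓₙ))) is a transverse sequence for (f(p), φ_p(ℓ)); in particular the sequence (f(pₙ)) converges along φ_p(ℓ) to f(p). -/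
open Filter Topology

noncomputable section

/-! ### Convergence in the projective line -/

/-- The Euclidean inner product of two plane vectors. -/
def planeInner (u v : Plane) : ℝ := u.1 * v.1 + u.2 * v.2

/-- The signed area spanned by two plane vectors. -/
def planeArea (u v : Plane) : ℝ := u.1 * v.2 - u.2 * v.1

lemma planeInner_self_pos {u : Plane} (hu : u ≠ 0) : 0 < planeInner u u := by
  have h : u.1 ≠ 0 ∨ u.2 ≠ 0 := by
    by_contra! h
    exact hu (Prod.ext h.1 h.2)
  unfold planeInner
  rcases h with h | h
  · have := mul_self_pos.mpr h
    nlinarith [mul_self_nonneg u.2]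
  · have := mul_self_pos.mpr h
    nlinarith [mul_self_nonneg u.1]

lemma exists_smul_eq_of_planeArea_eq_zero {u v : Plane} (hu : u ≠ 0)
    (h : planeArea u v = 0) : ∃ c : ℝ, c • u = v := by
  have hpos := planeInner_self_pos hu
  refine ⟨planeInner u v / planeInner u u, ?_⟩
  unfold planeArea at h
  ext
  · simp only [Prod.smul_fst, smul_eq_mul]
    rw [div_mul_eq_mul_div, div_eq_iff hpos.ne']
    unfold planeInner
    linear_combination u.2 * h
  · simp only [Prod.smul_snd, smul_eq_mul]
    rw [div_mul_eq_mul_div, div_eq_iff hpos.ne']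
    unfold planeInner
    linear_combination -u.1 * h

lemma mk_eq_mk_of_planeArea_eq_zero {u v : Plane} (hu : u ≠ 0) (hv : v ≠ 0)
    (h : planeArea u v = 0) : Projectivization.mk ℝ u hu = Projectivization.mk ℝ v hv := by
  obtain ⟨c, hc⟩ := exists_smul_eq_of_planeArea_eq_zero hu h
  exact ((Projectivization.mk_eq_mk_iff' ℝ v u hv hu).mpr ⟨c, hc⟩).symm

/-- The function `[w] ↦ ⟨u, w⟩² / ⟨w, w⟩` on the projective line. -/
def squaredCosine (u : Plane) : ProjLine → ℝ :=
  Projectivization.lift (fun w => planeInner u w.1 ^ 2 / planeInner w.1 w.1) (by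
    rintro ⟨a, ha⟩ ⟨b, hb⟩ t h
    dsimp only at h ⊢
    subst h
    have ht : t ≠ 0 := left_ne_zero_of_smul ha
    have hb' := (planeInner_self_pos hb).ne'
    have ha' := (planeInner_self_pos ha).ne'
    rw [div_eq_div_iff ha' hb']
    simp only [planeInner, Prod.smul_fst, Prod.smul_snd, smul_eq_mul]
    ring)

/-- The function `[w] ↦ ⟨u, w⟩ · area(u, w) / ⟨w, w⟩` on the projective line. -/
def cosineSine (u : Plane) : ProjLine → ℝ :=
  Projectivization.lift
    (fun w => planeInner u w.1 * planeArea u w.1 / planeInner w.1 w.1) (by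
    rintro ⟨a, ha⟩ ⟨b, hb⟩ t h
    dsimp only at h ⊢
    subst h
    have hb' := (planeInner_self_pos hb).ne'
    have ha' := (planeInner_self_pos ha).ne'
    rw [div_eq_div_iff ha' hb']
    simp only [planeInner, planeArea, Prod.smul_fst, Prod.smul_snd, smul_eq_mul]
    ring)

lemma continuous_squaredCosine (u : Plane) : Continuous (squaredCosine u) := by
  apply Continuous.quotient_lift
  refine Continuous.div ?_ ?_ fun w => (planeInner_self_pos w.2).ne'
  · unfold planeInner; fun_prop
  · unfold planeInner; fun_prop

lemma continuous_cosineSine (u : Plane) : Continuous (cosineSine u) := by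
  apply Continuous.quotient_lift
  refine Continuous.div ?_ ?_ fun w => (planeInner_self_pos w.2).ne'
  · unfold planeInner planeArea; fun_prop
  · unfold planeInner; fun_prop

lemma squaredCosine_mk (u : Plane) {w : Plane} (hw : w ≠ 0) :
    squaredCosine u (Projectivization.mk ℝ w hw) = planeInner u w ^ 2 / planeInner w w := rfl

lemma cosineSine_mk (u : Plane) {w : Plane} (hw : w ≠ 0) :
    cosineSine u (Projectivization.mk ℝ w hw)
      = planeInner u w * planeArea u w / planeInner w w := rfl

lemma squaredCosine_self {u : Plane} (hu : u ≠ 0) :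
    squaredCosine u (Projectivization.mk ℝ u hu) = planeInner u u := by
  rw [squaredCosine_mk, pow_two, mul_div_assoc, div_self (planeInner_self_pos hu).ne', mul_one]

lemma cosineSine_self {u : Plane} (hu : u ≠ 0) :
    cosineSine u (Projectivization.mk ℝ u hu) = 0 := by
  have : planeArea u u = 0 := by unfold planeArea; ring
  rw [cosineSine_mk, this]; simp

lemma projLine_tendsto_nhds_unique {ι : Type*} {F : Filter ι} [F.NeBot] {k : ι → ProjLine}
    {ℓ ℓ' : ProjLine} (h : Tendsto k F (𝓝 ℓ)) (h' : Tendsto k F (𝓝 ℓ')) : ℓ = ℓ' := by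
  induction ℓ using Projectivization.ind with
  | h u hu =>
  induction ℓ' using Projectivization.ind with
  | h v hv =>
  have h1 := tendsto_nhds_unique (((continuous_squaredCosine u).tendsto _).comp h)
    (((continuous_squaredCosine u).tendsto _).comp h')
  have h2 := tendsto_nhds_unique (((continuous_cosineSine u).tendsto _).comp h)
    (((continuous_cosineSine u).tendsto _).comp h')
  have hv' := planeInner_self_pos hv
  have hu' := planeInner_self_pos hu
  rw [squaredCosine_self, squaredCosine_mk] at h1
  rw [cosineSine_self, cosineSine_mk, eq_comm, div_eq_zero_iff, mul_eq_zero] at h2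
  have h3 : planeInner u v ≠ 0 := by
    intro h3
    rw [h3] at h1
    simp only [ne_eq, OfNat.ofNat_ne_zero, not_false_eq_true, zero_pow, zero_div] at h1
    exact hu'.ne' h1
  rcases h2 with (h2 | h2) | h2
  · exact absurd h2 h3
  · exact mk_eq_mk_of_planeArea_eq_zero hu hv h2
  · exact absurd h2 hv'.ne'

/-- Convergence of lines to `[u]` forces the slopes relative to `u` to tend to `0`. -/
lemma slope_tendsto_zero_of_tendsto_mk {ι : Type*} {F : Filter ι} {w : ι → Plane}
    (hw : ∀ i, w i ≠ 0) {u : Plane} (hu : u ≠ 0)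
    (h : Tendsto (fun i => Projectivization.mk ℝ (w i) (hw i)) F
      (𝓝 (Projectivization.mk ℝ u hu))) :
    (∀ᶠ i in F, planeInner u (w i) ≠ 0) ∧
      Tendsto (fun i => planeArea u (w i) / planeInner u (w i)) F (𝓝 0) := by
  have hu' := planeInner_self_pos hu
  have h1 := ((continuous_squaredCosine u).tendsto _).comp h
  have h2 := ((continuous_cosineSine u).tendsto _).comp h
  rw [squaredCosine_self] at h1
  rw [cosineSine_self] at h2
  have hne : ∀ᶠ i in F, planeInner u (w i) ≠ 0 := by
    filter_upwards [h1.eventually_ne hu'.ne'] with i hi h0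
    apply hi
    simp [squaredCosine_mk, h0]
  refine ⟨hne, ?_⟩
  have h3 := h2.div h1 hu'.ne'
  rw [zero_div] at h3
  refine h3.congr' ?_
  filter_upwards [hne] with i hi
  have := (planeInner_self_pos (hw i)).ne'
  simp only [Pi.div_apply, Function.comp_apply, squaredCosine_mk, cosineSine_mk]
  field_simp

lemma tendsto_mk {ι : Type*} {F : Filter ι} {w : ι → Plane} (hw : ∀ i, w i ≠ 0) {u : Plane}
    (hu : u ≠ 0) (h : Tendsto w F (𝓝 u)) :
    Tendsto (fun i => Projectivization.mk ℝ (w i) (hw i)) F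
      (𝓝 (Projectivization.mk ℝ u hu)) := by
  have hc : Continuous (fun v : {v : Plane // v ≠ 0} => Projectivization.mk ℝ v.1 v.2) :=
    continuous_quotient_mk'
  have h' : Tendsto (fun i => (⟨w i, hw i⟩ : {v : Plane // v ≠ 0})) F (𝓝 ⟨u, hu⟩) :=
    tendsto_subtype_rng.mpr h
  exact (hc.tendsto _).comp h'

lemma secantDir_of_ne {q x : Plane} (h : x ≠ q) :
    secantDir q x = Projectivization.mk ℝ (x - q) (sub_ne_zero.mpr h) := dif_neg h

/-! ### Tangent lines of curves -/

lemma IsRegParam.exists_int_of_eq {γ : ℝ → Plane} (h : IsRegParam γ) {s t : ℝ}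
    (hst : γ s = γ t) : ∃ z : ℤ, s - t = z := by
  have hfr : ∀ r : ℝ, γ (Int.fract r) = γ r := fun r => by
    have := h.2.1.sub_zsmul_eq (x := r) ⌊r⌋
    rwa [zsmul_one] at this
  refine Int.fract_eq_fract.mp (h.2.2.1 ⟨Int.fract_nonneg s, Int.fract_lt_one s⟩
    ⟨Int.fract_nonneg t, Int.fract_lt_one t⟩ ?_)
  rw [hfr, hfr, hst]

lemma IsRegParam.hasDerivAt {γ : ℝ → Plane} (h : IsRegParam γ) (t : ℝ) :
    HasDerivAt γ (deriv γ t) t :=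
  (h.1.differentiable one_ne_zero t).hasDerivAt

/-- Points of the curve converging to `γ t₀` have parameters converging to `t₀`. -/
lemma IsRegParam.exists_tendsto_param {γ : ℝ → Plane} (h : IsRegParam γ) (t₀ : ℝ)
    {x : ℕ → Plane} (hx : ∀ n, x n ∈ Set.range γ) (hlim : Tendsto x atTop (𝓝 (γ t₀))) :
    ∃ t : ℕ → ℝ, (∀ n, γ (t n) = x n) ∧ Tendsto t atTop (𝓝 t₀) := by
  have hex : ∀ n, ∃ t, t ∈ Set.Icc (t₀ - 1 / 2) (t₀ + 1 / 2) ∧ γ t = x n := by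
    intro n
    obtain ⟨s, hs⟩ := hx n
    refine ⟨s - round (s - t₀), ?_, ?_⟩
    · have := abs_le.mp (abs_sub_round (s - t₀))
      constructor <;> linarith [this.1, this.2]
    · rw [← hs]
      simpa using h.2.1.sub_zsmul_eq (x := s) (round (s - t₀))
  choose t ht htx using hex
  refine ⟨t, htx, isCompact_Icc.tendsto_nhds_of_unique_mapClusterPt
    (Eventually.of_forall ht) fun s hs hcl => ?_⟩
  have h1 : MapClusterPt (γ s) atTop (γ ∘ t) :=
    hcl.continuousAt_comp h.1.continuous.continuousAt
  have h2 : γ ∘ t = x := funext htx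
  rw [h2] at h1
  have h3 : γ s = γ t₀ := by
    have : (𝓝 (γ s) ⊓ map x atTop).NeBot := h1
    exact eq_of_nhds_neBot (this.mono (inf_le_inf_left _ hlim))
  obtain ⟨z, hz⟩ := h.exists_int_of_eq h3
  have hz0 : z = 0 := by
    have h4 : ((-1 : ℤ) : ℝ) < z := by rw [← hz]; push_cast; linarith [hs.1]
    have h5 : (z : ℝ) < (1 : ℤ) := by rw [← hz]; push_cast; linarith [hs.2]
    have h4' := Int.cast_lt.mp h4
    have h5' := Int.cast_lt.mp h5
    omega
  rw [hz0] at hz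
  push_cast at hz
  linarith

/-- Secants of a curve through `p` converge to its tangent line at `p`. -/
lemma TangentAt.tendsto_secantDir {Γ : Set Plane} {p : Plane} {ℓ : ProjLine}
    (h : TangentAt Γ p ℓ) {x : ℕ → Plane} (hx : ∀ n, x n ∈ Γ) (hxp : ∀ n, x n ≠ p)
    (hlim : Tendsto x atTop (𝓝 p)) :
    Tendsto (fun n => secantDir p (x n)) atTop (𝓝 ℓ) := by
  obtain ⟨γ, t₀, hγ, rfl, rfl, rfl⟩ := h
  obtain ⟨t, htx, ht⟩ := hγ.exists_tendsto_param t₀ hx hlim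
  have htne : ∀ n, t n ≠ t₀ := fun n hn => hxp n (by rw [← htx n, hn])
  have hsl : Tendsto (fun n => slope γ t₀ (t n)) atTop (𝓝 (deriv γ t₀)) :=
    (hasDerivAt_iff_tendsto_slope.mp (hγ.hasDerivAt t₀)).comp
      (tendsto_nhdsWithin_iff.mpr ⟨ht, Eventually.of_forall htne⟩)
  have hform : ∀ n, slope γ t₀ (t n) = (t n - t₀)⁻¹ • (x n - γ t₀) := fun n => by
    rw [slope_def_module, htx]
  have hne : ∀ n, slope γ t₀ (t n) ≠ 0 := fun n => by
    rw [hform]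
    exact smul_ne_zero (inv_ne_zero (sub_ne_zero.mpr (htne n))) (sub_ne_zero.mpr (hxp n))
  refine (tendsto_mk hne (hγ.2.2.2 t₀) hsl).congr fun n => ?_
  rw [secantDir_of_ne (hxp n), Projectivization.mk_eq_mk_iff']
  exact ⟨_, (hform n).symm⟩

lemma TangentAt.unique {Γ : Set Plane} {p : Plane} {ℓ ℓ' : ProjLine}
    (h : TangentAt Γ p ℓ) (h' : TangentAt Γ p ℓ') : ℓ = ℓ' := by
  obtain ⟨γ, t₀, hγ, hΓ, hp, -⟩ := id h
  have hpos : ∀ n : ℕ, 0 < (1 : ℝ) / ((n : ℝ) + 1) := fun n => by positivity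
  have hu : Tendsto (fun n : ℕ => t₀ + 1 / 2 * (1 / ((n : ℝ) + 1))) atTop (𝓝 t₀) := by
    simpa only [mul_zero, add_zero] using
      ((tendsto_one_div_add_atTop_nhds_zero_nat (𝕜 := ℝ)).const_mul (1 / 2)).const_add t₀
  have hx : ∀ n : ℕ, γ (t₀ + 1 / 2 * (1 / ((n : ℝ) + 1))) ∈ Γ := fun n => by
    rw [hΓ]; exact Set.mem_range_self _
  have hlim : Tendsto (fun n : ℕ => γ (t₀ + 1 / 2 * (1 / ((n : ℝ) + 1)))) atTop (𝓝 p) := by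
    rw [← hp]; exact (hγ.1.continuous.tendsto t₀).comp hu
  have hne : ∀ n : ℕ, γ (t₀ + 1 / 2 * (1 / ((n : ℝ) + 1))) ≠ p := by
    intro n hn
    rw [← hp] at hn
    obtain ⟨z, hz⟩ := hγ.exists_int_of_eq hn
    have h1 : (1 : ℝ) / ((n : ℝ) + 1) ≤ 1 := by
      rw [div_le_one (by positivity)]; linarith [(Nat.cast_nonneg n : (0 : ℝ) ≤ n)]
    have h4 : ((0 : ℤ) : ℝ) < z := by rw [← hz]; push_cast; linarith [hpos n]
    have h5 : (z : ℝ) < (1 : ℤ) := by rw [← hz]; push_cast; linarith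
    have h4' := Int.cast_lt.mp h4
    have h5' := Int.cast_lt.mp h5
    omega
  exact projLine_tendsto_nhds_unique (h.tendsto_secantDir hx hne hlim)
    (h'.tendsto_secantDir hx hne hlim)

/-- The tangent line of a curve varies continuously along the curve. -/
lemma TangentAt.tendsto_tangent {Γ : Set Plane} {p : Plane} {ℓ : ProjLine}
    (h : TangentAt Γ p ℓ) {x : ℕ → Plane} {k : ℕ → ProjLine}
    (hx : ∀ n, TangentAt Γ (x n) (k n)) (hlim : Tendsto x atTop (𝓝 p)) :
    Tendsto k atTop (𝓝 ℓ) := by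
  obtain ⟨γ, t₀, hγ, rfl, rfl, rfl⟩ := h
  have hmem : ∀ n, x n ∈ Set.range γ := fun n => by
    obtain ⟨η, s, -, hΓ, hs, -⟩ := hx n
    rw [hΓ, ← hs]; exact Set.mem_range_self s
  obtain ⟨t, htx, ht⟩ := hγ.exists_tendsto_param t₀ hmem hlim
  have hd := ((hγ.1.continuous_deriv le_rfl).tendsto t₀).comp ht
  refine (tendsto_mk (fun n => hγ.2.2.2 (t n)) (hγ.2.2.2 t₀) hd).congr fun n => ?_
  exact TangentAt.unique ⟨γ, t n, hγ, rfl, htx n, rfl⟩ (hx n)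

/-! ### Interpolation by C¹ functions -/

/-- There are C¹ functions supported in `[-1, 1]` with prescribed `1`-jets `(1, 0)` and `(0, 1)`
at the origin. -/
lemma exists_interpolation_bumps : ∃ (ψ χ ψ' χ' : ℝ → ℝ) (C : ℝ),
    (∀ s, HasDerivAt ψ (ψ' s) s) ∧ (∀ s, HasDerivAt χ (χ' s) s) ∧
    Continuous ψ' ∧ Continuous χ' ∧
    (ψ 0 = 1 ∧ ψ' 0 = 0 ∧ χ 0 = 0 ∧ χ' 0 = 1) ∧
    (∀ s, 1 < |s| → ψ s = 0 ∧ ψ' s = 0 ∧ χ s = 0 ∧ χ' s = 0) ∧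
    ∀ s, |ψ' s| ≤ C ∧ |χ' s| ≤ C := by
  let B : ContDiffBump (0 : ℝ) := ⟨1 / 2, 1, by norm_num, by norm_num⟩
  have hB : ContDiff ℝ 1 (B : ℝ → ℝ) := B.contDiff
  have hd : ∀ s, HasDerivAt (B : ℝ → ℝ) (deriv B s) s := fun s =>
    (hB.differentiable one_ne_zero s).hasDerivAt
  have hdc : Continuous (deriv (B : ℝ → ℝ)) := hB.continuous_deriv le_rfl
  have hcs : HasCompactSupport (B : ℝ → ℝ) := B.hasCompactSupport
  have hB0 : B 0 = 1 := B.eventuallyEq_one.eq_of_nhds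
  have hB'0 : deriv B 0 = 0 := by
    rw [B.eventuallyEq_one.deriv_eq]
    exact deriv_const 0 1
  have hout : ∀ s : ℝ, 1 < |s| → B s = 0 ∧ deriv B s = 0 := by
    intro s hs
    have hns : s ∉ tsupport (B : ℝ → ℝ) := by
      rw [B.tsupport_eq, Metric.mem_closedBall, dist_zero_right, Real.norm_eq_abs, not_le]
      exact hs
    exact ⟨image_eq_zero_of_notMem_tsupport hns, by
      by_contra h
      exact hns (support_deriv_subset h)⟩
  obtain ⟨C₁, hC₁⟩ := hdc.bounded_above_of_compact_support hcs.deriv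
  have hχc : Continuous fun s => B s + s * deriv B s := by
    have := hB.continuous
    fun_prop
  obtain ⟨C₂, hC₂⟩ := hχc.bounded_above_of_compact_support
    (hcs.add (hcs.deriv.mul_left (f := fun s : ℝ => s)))
  refine ⟨B, fun s => s * B s, deriv B, fun s => B s + s * deriv B s, max C₁ C₂, hd,
    fun s => ?_, hdc, hχc, ⟨hB0, hB'0, by simp, by simp [hB0]⟩, fun s hs => ?_, fun s =>
    ⟨(hC₁ s).trans (le_max_left _ _), (hC₂ s).trans (le_max_right _ _)⟩⟩
  · exact ((hasDerivAt_id' s).mul (hd s)).congr_deriv (by rw [one_mul])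
  · obtain ⟨h1, h2⟩ := hout s hs
    simp [h1, h2]

/-- A sequence tending to `0` has a subsequence with geometrically decreasing absolute values. -/
lemma exists_subseq_abs_lt_half {a : ℕ → ℝ} (ha : Tendsto a atTop (𝓝 0)) {Q : ℕ → Prop}
    (hQ : ∀ᶠ n in atTop, Q n) (hQa : ∀ n, Q n → a n ≠ 0) :
    ∃ σ : ℕ → ℕ, StrictMono σ ∧ (∀ n, Q (σ n)) ∧
      ∀ m n, m < n → |a (σ n)| < |a (σ m)| / 2 := by
  obtain ⟨σ, h1, h2⟩ := exists_seq_of_forall_finset_exists Q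
    (fun m n => m < n ∧ |a n| < |a m| / 2) (by
      intro s hs
      have hev : ∀ᶠ n in atTop, ∀ m ∈ s, m < n ∧ |a n| < |a m| / 2 := by
        rw [Filter.eventually_all_finset]
        intro m hm
        have hpos : 0 < |a m| / 2 := half_pos (abs_pos.mpr (hQa m (hs m hm)))
        refine (eventually_gt_atTop m).and ?_
        have := ha.abs
        rw [abs_zero] at this
        exact this.eventually_lt_const hpos
      exact (hQ.and hev).exists)
  exact ⟨σ, fun m n h => (h2 m n h).1, h1, fun m n h => (h2 m n h).2⟩

/-- Up to passing to a subsequence, `1`-jets `(bₙ, mₙ)` at `aₙ → 0` with `bₙ / aₙ → 0` and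
`mₙ → 0` are interpolated by a C¹ function with vanishing `1`-jet at `0`. -/
lemma exists_C1_interpolation {a b m : ℕ → ℝ} (ha : Tendsto a atTop (𝓝 0))
    (hb : Tendsto (fun n => b n / a n) atTop (𝓝 0)) (hm : Tendsto m atTop (𝓝 0))
    {Q : ℕ → Prop} (hQ : ∀ᶠ n in atTop, Q n) (hQa : ∀ n, Q n → a n ≠ 0) :
    ∃ (σ : ℕ → ℕ) (g g' : ℝ → ℝ), StrictMono σ ∧ (∀ n, Q (σ n)) ∧
      (∀ s, HasDerivAt g (g' s) s) ∧ Continuous g' ∧ g 0 = 0 ∧ g' 0 = 0 ∧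
      ∀ n, g (a (σ n)) = b (σ n) ∧ g' (a (σ n)) = m (σ n) := by
  obtain ⟨ψ, χ, ψ', χ', C, hψ, hχ, hψc, hχc, ⟨hψ0, hψ'0, hχ0, hχ'0⟩, hout, hC⟩ :=
    exists_interpolation_bumps
  obtain ⟨σ, hσ, hσQ, hσa⟩ := exists_subseq_abs_lt_half ha hQ hQa
  have hsmall : Tendsto (fun n => C * (4 * |b (σ n) / a (σ n)| + |m (σ n)|)) atTop (𝓝 0) := by
    have := (((hb.abs.const_mul 4).add hm.abs).const_mul C).comp hσ.tendsto_atTop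
    simpa [Function.comp_def] using this
  obtain ⟨τ, hτ, hτs⟩ := extraction_forall_of_eventually
    (P := fun n k => C * (4 * |b (σ k) / a (σ k)| + |m (σ k)|) < (1 / 2 : ℝ) ^ n)
    (fun n => hsmall.eventually_lt_const (by positivity))
  set A : ℕ → ℝ := fun n => a (σ (τ n)) with hA
  set β : ℕ → ℝ := fun n => b (σ (τ n)) with hβ
  set μ : ℕ → ℝ := fun n => m (σ (τ n)) with hμ
  have hA0 : ∀ n, A n ≠ 0 := fun n => hQa _ (hσQ _)
  have hAlt : ∀ i j, i < j → |A j| < |A i| / 2 := fun i j h => hσa _ _ (hτ h)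
  let S : ℕ → ℝ → ℝ := fun n s => 4 * (s - A n) / A n
  let h : ℕ → ℝ → ℝ := fun n s => β n * ψ (S n s) + μ n * A n / 4 * χ (S n s)
  let h' : ℕ → ℝ → ℝ := fun n s => 4 * (β n / A n) * ψ' (S n s) + μ n * χ' (S n s)
  have hder : ∀ n s, HasDerivAt (h n) (h' n s) s := by
    intro n s
    have hS : HasDerivAt (S n) (4 / A n) s := by
      simpa using (((hasDerivAt_id s).sub_const (A n)).const_mul 4).div_const (A n)
    have h1 := (((hψ (S n s)).comp s hS).const_mul (β n)).add
      (((hχ (S n s)).comp s hS).const_mul (μ n * A n / 4))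
    refine h1.congr_deriv ?_
    have := hA0 n
    simp only [h']
    field_simp
  have hbound : ∀ n s, ‖h' n s‖ ≤ (1 / 2 : ℝ) ^ n := by
    intro n s
    refine le_trans ?_ (hτs n).le
    obtain ⟨hC1, hC2⟩ := hC (S n s)
    calc |4 * (β n / A n) * ψ' (S n s) + μ n * χ' (S n s)|
        ≤ |4 * (β n / A n) * ψ' (S n s)| + |μ n * χ' (S n s)| := abs_add_le _ _
      _ = 4 * |β n / A n| * |ψ' (S n s)| + |μ n| * |χ' (S n s)| := by
          rw [abs_mul, abs_mul, abs_mul]; norm_num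
      _ ≤ 4 * |β n / A n| * C + |μ n| * C := by gcongr
      _ = C * (4 * |β n / A n| + |μ n|) := by ring
  have hvan : ∀ n s, 1 < |S n s| → h n s = 0 ∧ h' n s = 0 := by
    intro n s hs
    obtain ⟨h1, h2, h3, h4⟩ := hout _ hs
    simp [h, h', h1, h2, h3, h4]
  have hS0 : ∀ n, 1 < |S n 0| := by
    intro n
    have : S n 0 = -4 := by
      have := hA0 n
      simp only [S]
      field_simp
      ring
    rw [this]; norm_num
  have hSne : ∀ i j, i ≠ j → 1 < |S i (A j)| := by
    intro i j hij
    have hi := abs_pos.mpr (hA0 i)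
    have hj := abs_pos.mpr (hA0 j)
    simp only [S]
    rw [abs_div, abs_mul, lt_div_iff₀ hi, one_mul, abs_of_pos (by norm_num : (0 : ℝ) < 4)]
    rcases lt_or_gt_of_ne hij with hlt | hlt
    · have h1 := hAlt _ _ hlt
      have h2 := abs_sub_abs_le_abs_sub (A i) (A j)
      rw [abs_sub_comm] at h2
      linarith
    · have h1 := hAlt _ _ hlt
      have h2 := abs_sub_abs_le_abs_sub (A j) (A i)
      linarith
  have hgeo : Summable fun n : ℕ => (1 / 2 : ℝ) ^ n := summable_geometric_two
  have hat : ∀ n, h n (A n) = β n ∧ h' n (A n) = μ n := by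
    intro n
    have : S n (A n) = 0 := by simp [S]
    simp [h, h', this, hψ0, hψ'0, hχ0, hχ'0]
  refine ⟨σ ∘ τ, fun s => ∑' n, h n s, fun s => ∑' n, h' n s, hσ.comp hτ, fun n => hσQ _,
    fun s => hasDerivAt_tsum hgeo hder hbound (y₀ := 0) ?_ s,
    continuous_tsum (fun n => ?_) hgeo hbound, ?_, ?_, fun n => ⟨?_, ?_⟩⟩
  · simp only [(hvan _ _ (hS0 _)).1]
    exact summable_zero
  · simp only [h', S]
    fun_prop
  · simp only [(hvan _ _ (hS0 _)).1, tsum_zero]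
  · simp only [(hvan _ _ (hS0 _)).2, tsum_zero]
  · change ∑' i, h i (A n) = β n
    rw [tsum_eq_single n fun i hi => (hvan _ _ (hSne i n hi)).1, (hat n).1]
  · change ∑' i, h' i (A n) = μ n
    rw [tsum_eq_single n fun i hi => (hvan _ _ (hSne i n hi)).2, (hat n).2]

/-! ### Interpolation by closed curves -/

/-- Rotation of a plane vector by a right angle. -/
def planeRot (u : Plane) : Plane := (-u.2, u.1)

lemma frame_injective {u : Plane} (hu : u ≠ 0) {a b c d : ℝ}
    (h : a • u + b • planeRot u = c • u + d • planeRot u) : a = c ∧ b = d := by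
  have hN := (planeInner_self_pos hu).ne'
  have h1 := congrArg Prod.fst h
  have h2 := congrArg Prod.snd h
  simp only [planeRot, Prod.fst_add, Prod.snd_add, Prod.smul_fst, Prod.smul_snd,
    smul_eq_mul] at h1 h2
  constructor
  · apply mul_right_cancel₀ hN
    unfold planeInner
    linear_combination u.1 * h1 + u.2 * h2
  · apply mul_right_cancel₀ hN
    unfold planeInner
    linear_combination u.1 * h2 - u.2 * h1

lemma frame_decomposition {u : Plane} (hu : u ≠ 0) (v : Plane) :
    (planeInner u v / planeInner u u) • u + (planeArea u v / planeInner u u) • planeRot u = v := by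
  have hN := (planeInner_self_pos hu).ne'
  ext
  · simp only [planeRot, Prod.fst_add, Prod.smul_fst, smul_eq_mul]
    field_simp
    unfold planeInner planeArea
    ring
  · simp only [planeRot, Prod.snd_add, Prod.smul_snd, smul_eq_mul]
    field_simp
    unfold planeInner planeArea
    ring

/-- The unit circle tangent to `u` at `p`, in the frame `(u, planeRot u)`, sheared by `g`. -/
def shearedCircle (p u : Plane) (g : ℝ → ℝ) (t : ℝ) : Plane :=
  p + (Real.sin (2 * Real.pi * t) • u +
    (g (Real.sin (2 * Real.pi * t)) + 1 - Real.cos (2 * Real.pi * t)) • planeRot u)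

lemma hasDerivAt_shearedCircle (p u : Plane) {g g' : ℝ → ℝ}
    (hg : ∀ s, HasDerivAt g (g' s) s) (t : ℝ) :
    HasDerivAt (shearedCircle p u g)
      ((2 * Real.pi * Real.cos (2 * Real.pi * t)) • u +
        (2 * Real.pi * (g' (Real.sin (2 * Real.pi * t)) * Real.cos (2 * Real.pi * t) +
          Real.sin (2 * Real.pi * t))) • planeRot u) t := by
  have hl : HasDerivAt (fun t : ℝ => 2 * Real.pi * t) (2 * Real.pi) t := by
    simpa using (hasDerivAt_id t).const_mul (2 * Real.pi)
  have hs := hl.sin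
  have hc := hl.cos
  have hgs := (hg (Real.sin (2 * Real.pi * t))).comp t hs
  have h := ((hs.smul_const u).add
    (((hgs.add_const 1).sub hc).smul_const (planeRot u))).const_add p
  refine h.congr_deriv ?_
  congr 2 <;> ring

lemma isRegParam_shearedCircle (p : Plane) {u : Plane} (hu : u ≠ 0) {g g' : ℝ → ℝ}
    (hg : ∀ s, HasDerivAt g (g' s) s) (hg' : Continuous g') :
    IsRegParam (shearedCircle p u g) := by
  have hd := hasDerivAt_shearedCircle p u hg
  have hpi := Real.pi_pos
  refine ⟨contDiff_one_iff_deriv.mpr ⟨fun t => (hd t).differentiableAt, ?_⟩, fun t => ?_,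
    fun s hs t ht hst => ?_, fun t ht => ?_⟩
  · rw [funext fun t => (hd t).deriv]
    fun_prop
  · simp [shearedCircle, mul_add, Real.sin_add_two_pi, Real.cos_add_two_pi]
  · obtain ⟨h1, h2⟩ := frame_injective hu (add_left_cancel hst)
    rw [h1] at h2
    have h3 : Real.cos (2 * Real.pi * s) = Real.cos (2 * Real.pi * t) := by linarith
    obtain ⟨z, hz⟩ := Real.Angle.angle_eq_iff_two_pi_dvd_sub.mp (Real.Angle.cos_sin_inj h3 h1)
    have hz' : s - t = z := by
      have : 2 * Real.pi * (s - t) = 2 * Real.pi * z := by linarith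
      exact mul_left_cancel₀ (by positivity) this
    have h4 : ((-1 : ℤ) : ℝ) < z := by rw [← hz']; push_cast; linarith [hs.1, ht.2]
    have h5 : (z : ℝ) < (1 : ℤ) := by rw [← hz']; push_cast; linarith [hs.2, ht.1]
    have h4' := Int.cast_lt.mp h4
    have h5' := Int.cast_lt.mp h5
    have hz0 : z = 0 := by omega
    rw [hz0] at hz'
    push_cast at hz'
    linarith
  · rw [(hd t).deriv] at ht
    obtain ⟨h1, h2⟩ := frame_injective hu (c := 0) (d := 0) (by simpa using ht)
    have h3 : Real.cos (2 * Real.pi * t) = 0 := by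
      simpa [hpi.ne'] using h1
    have h4 : Real.sin (2 * Real.pi * t) = 0 := by
      simpa [hpi.ne', h3] using h2
    have := Real.sin_sq_add_cos_sq (2 * Real.pi * t)
    rw [h3, h4] at this
    norm_num at this

/-- Up to passing to a subsequence, points converging to `p` along `ℓ` together with lines
converging to `ℓ` are interpolated by a simple closed C¹ curve. -/
lemma exists_curve_through_subseq {p : Plane} {ℓ : ProjLine} {x : ℕ → Plane} {k : ℕ → ProjLine}
    (hx : ConvAlong p ℓ x) (hk : Tendsto k atTop (𝓝 ℓ)) :
    ∃ (σ : ℕ → ℕ) (Γ : Set Plane), StrictMono σ ∧ TangentAt Γ p ℓ ∧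
      ∀ n, TangentAt Γ (x (σ n)) (k (σ n)) := by
  obtain ⟨hxp, hxlim, hxdir⟩ := hx
  induction ℓ using Projectivization.ind with
  | h u hu =>
  have hN := (planeInner_self_pos hu).ne'
  have hxdir' := hxdir.congr fun n => secantDir_of_ne (hxp n)
  obtain ⟨hxne, hxslope⟩ := slope_tendsto_zero_of_tendsto_mk _ hu hxdir'
  have hk' := hk.congr fun n => (Projectivization.mk_rep (k n)).symm
  obtain ⟨hkne, hkslope⟩ := slope_tendsto_zero_of_tendsto_mk _ hu hk'
  set a : ℕ → ℝ := fun n => planeInner u (x n - p) / planeInner u u with ha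
  set b : ℕ → ℝ := fun n => planeArea u (x n - p) / planeInner u u with hb
  set m : ℕ → ℝ := fun n => planeArea u (k n).rep / planeInner u (k n).rep with hm
  have halim : Tendsto a atTop (𝓝 0) := by
    have hc : Continuous fun q : Plane => planeInner u (q - p) / planeInner u u := by
      unfold planeInner; fun_prop
    have := (hc.tendsto p).comp hxlim
    simpa [planeInner, Function.comp_def, ha] using this
  have hba : Tendsto (fun n => b n / a n) atTop (𝓝 0) := by
    refine hxslope.congr fun n => ?_
    simp only [ha, hb]
    rw [div_div_div_cancel_right₀ hN]
  have hcirc : Tendsto (fun n => (1 - √(1 - a n ^ 2)) / a n) atTop (𝓝 0) := by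
    have habs : Tendsto (fun n => |a n|) atTop (𝓝 0) := by simpa using halim.abs
    refine squeeze_zero_norm (fun n => ?_) habs
    have h1 : √(1 - a n ^ 2) ≤ 1 := by
      rw [Real.sqrt_le_left zero_le_one]; nlinarith [sq_nonneg (a n)]
    have h2 : 1 - a n ^ 2 ≤ √(1 - a n ^ 2) := by
      rcases le_total (1 - a n ^ 2) 0 with h | h
      · exact h.trans (Real.sqrt_nonneg _)
      · exact Real.le_sqrt_of_sq_le (by nlinarith [sq_nonneg (a n)])
    rw [norm_div, Real.norm_eq_abs, Real.norm_eq_abs, abs_of_nonneg (by linarith)]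
    refine div_le_of_le_mul₀ (abs_nonneg _) (abs_nonneg _) ?_
    rw [abs_mul_abs_self]
    linarith
  have hmlim : Tendsto (fun n => m n - a n / √(1 - a n ^ 2)) atTop (𝓝 0) := by
    have h1 : Tendsto (fun n => √(1 - a n ^ 2)) atTop (𝓝 1) := by
      simpa using ((halim.pow 2).const_sub 1).sqrt
    simpa using hkslope.sub (halim.div h1 one_ne_zero)
  have hblim : Tendsto (fun n => (b n - (1 - √(1 - a n ^ 2))) / a n) atTop (𝓝 0) := by
    simpa [sub_div] using hba.sub hcirc
  have hQ : ∀ᶠ n in atTop, a n ≠ 0 ∧ |a n| < 1 ∧ planeInner u (k n).rep ≠ 0 := by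
    have habs : Tendsto (fun n => |a n|) atTop (𝓝 0) := by simpa using halim.abs
    filter_upwards [hxne, habs.eventually_lt_const one_pos, hkne] with n h1 h2 h3
    exact ⟨div_ne_zero h1 hN, h2, h3⟩
  obtain ⟨σ, g, g', hσ, hσQ, hg, hgc, hg0, hg'0, hgσ⟩ :=
    exists_C1_interpolation halim hblim hmlim hQ fun n h => h.1
  have hreg := isRegParam_shearedCircle p hu hg hgc
  refine ⟨σ, Set.range (shearedCircle p u g), hσ, ⟨_, 0, hreg, rfl, ?_, ?_⟩, fun n =>
    ⟨_, Real.arcsin (a (σ n)) / (2 * Real.pi), hreg, rfl, ?_, ?_⟩⟩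
  · simp [shearedCircle, hg0]
  · rw [Projectivization.mk_eq_mk_iff']
    refine ⟨(2 * Real.pi)⁻¹, ?_⟩
    rw [(hasDerivAt_shearedCircle p u hg 0).deriv]
    simp only [mul_zero, Real.cos_zero, Real.sin_zero, hg'0, add_zero, zero_smul,
      mul_one]
    exact inv_smul_smul₀ (by positivity) u
  all_goals
    obtain ⟨-, hlt, hin⟩ := hσQ n
    obtain ⟨hgn, hgn'⟩ := hgσ n
    have harg : 2 * Real.pi * (Real.arcsin (a (σ n)) / (2 * Real.pi)) = Real.arcsin (a (σ n)) :=
      mul_div_cancel₀ _ (by positivity)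
    have hsin : Real.sin (Real.arcsin (a (σ n))) = a (σ n) :=
      Real.sin_arcsin (abs_lt.mp hlt).1.le (abs_lt.mp hlt).2.le
  · rw [shearedCircle, harg, hsin, Real.cos_arcsin, hgn]
    have h1 : b (σ n) - (1 - √(1 - a (σ n) ^ 2)) + 1 - √(1 - a (σ n) ^ 2) = b (σ n) := by ring
    rw [h1, frame_decomposition hu (x (σ n) - p)]
    abel
  · have hsq : √(1 - a (σ n) ^ 2) ≠ 0 := by
      rw [Real.sqrt_ne_zero']
      have := (sq_lt_one_iff_abs_lt_one _).mpr hlt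
      linarith
    have hd := (hasDerivAt_shearedCircle p u hg (Real.arcsin (a (σ n)) / (2 * Real.pi))).deriv
    rw [harg, hsin, Real.cos_arcsin, hgn'] at hd
    have hslope : m (σ n) * planeInner u (k (σ n)).rep = planeArea u (k (σ n)).rep :=
      div_mul_cancel₀ _ hin
    nth_rw 1 [← Projectivization.mk_rep (k (σ n))]
    refine (mk_eq_mk_of_planeArea_eq_zero _ _ ?_).symm
    rw [hd, sub_mul, div_mul_cancel₀ _ hsq, sub_add_cancel]
    simp only [planeArea, planeInner, planeRot, Prod.fst_add, Prod.snd_add, Prod.smul_fst,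
      Prod.smul_snd, smul_eq_mul] at hslope ⊢
    linear_combination (-2 * Real.pi * √(1 - a (σ n) ^ 2)) * hslope

lemma ConvAlong.comp {p : Plane} {ℓ : ProjLine} {x : ℕ → Plane} (h : ConvAlong p ℓ x)
    {ns : ℕ → ℕ} (hns : Tendsto ns atTop atTop) : ConvAlong p ℓ (x ∘ ns) :=
  ⟨fun n => h.1 (ns n), h.2.1.comp hns, h.2.2.comp hns⟩

lemma TangentAt.mem {Γ : Set Plane} {p : Plane} {ℓ : ProjLine} (h : TangentAt Γ p ℓ) : p ∈ Γ := by
  obtain ⟨γ, t, -, rfl, rfl, -⟩ := h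
  exact Set.mem_range_self t

lemma IsC1Curve.exists_tangentAt {Γ : Set Plane} (h : IsC1Curve Γ) {p : Plane} (hp : p ∈ Γ) :
    ∃ ℓ, TangentAt Γ p ℓ := by
  obtain ⟨γ, hγ, rfl⟩ := h
  obtain ⟨t, rfl⟩ := hp
  exact ⟨_, γ, t, hγ, rfl, rfl, rfl⟩

lemma TangentAt.isC1Curve {Γ : Set Plane} {p : Plane} {ℓ : ProjLine} (h : TangentAt Γ p ℓ) :
    IsC1Curve Γ := by
  obtain ⟨γ, t, hγ, hΓ, -, -⟩ := h
  exact ⟨γ, hγ, hΓ⟩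

lemma ConvAlong.image (f : Plane ≃ₜ Plane) {p : Plane} {φ : ProjLine ≃ₜ ProjLine}
    (hφ : InducesAt f p φ) {ℓ : ProjLine} {x : ℕ → Plane} (h : ConvAlong p ℓ x) :
    ConvAlong (f p) (φ ℓ) (fun n => f (x n)) := by
  have hne : ∀ n, f (x n) ≠ f p := fun n => f.injective.ne (h.1 n)
  have hlim : Tendsto (fun n => f (x n)) atTop (𝓝 (f p)) := (f.continuous.tendsto p).comp h.2.1
  refine ⟨hne, hlim, tendsto_of_subseq_tendsto fun ns hns => ?_⟩
  obtain ⟨σ, Γ, hσ, hΓ, hΓx⟩ :=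
    exists_curve_through_subseq (h.comp hns) (tendsto_const_nhds (x := ℓ))
  exact ⟨σ, (hφ Γ ℓ hΓ).2.tendsto_secantDir (fun n => Set.mem_image_of_mem f (hΓx n).mem)
    (fun n => hne _) (hlim.comp (hns.comp hσ.tendsto_atTop))⟩

/-- The tangent lines of a preimage curve are the preimages of the tangent lines. -/
lemma TangentAt.preimage (f : Plane ≃ₜ Plane) (hf : MapsC1 f.symm) {p : Plane}
    {φ : ProjLine ≃ₜ ProjLine} (hφ : InducesAt f p φ) {Γ : Set Plane} {ℓ : ProjLine}
    (h : TangentAt Γ (f p) (φ ℓ)) : TangentAt (f.symm '' Γ) p ℓ := by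
  obtain ⟨ℓ', h'⟩ := (hf Γ h.isC1Curve).exists_tangentAt (p := p) ⟨f p, h.mem, by simp⟩
  have himg : f '' (f.symm '' Γ) = Γ := by
    rw [← Set.image_comp, f.self_comp_symm, Set.image_id]
  have h1 := (hφ _ _ h').2
  rw [himg] at h1
  rwa [φ.injective (h.unique h1)]

/-- Elements of `Homeo¹(ℝ²)` map transverse sequences for `(p, ℓ)` to transverse
sequences for `(f(p), φ_p(ℓ))`; in particular `(f(pₙ))` converges along `φ_p(ℓ)`
to `f(p)`. -/
theorem transverse_sequence_preserved (f : Plane ≃ₜ Plane) (hf : InHomeo1 f)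
    (φ : Plane → (ProjLine ≃ₜ ProjLine)) (hφ : ∀ q : Plane, InducesAt ⇑f q (φ q))
    (p : Plane) (ℓ : ProjLine) (x : ℕ → Plane) (k : ℕ → ProjLine)
    (ht : TransverseFor p ℓ x k) :
    TransverseFor (f p) (φ p ℓ) (fun n => f (x n)) (fun n => φ (x n) (k n)) ∧
      ConvAlong (f p) (φ p ℓ) (fun n => f (x n)) := by
  have hconv : ConvAlong (f p) (φ p ℓ) (fun n => f (x n)) := ht.1.image f (hφ p)
  refine ⟨⟨hconv, fun ψ hψ hlim => ?_⟩, hconv⟩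
  obtain ⟨σ, Γ, hσ, hΓ, hΓx⟩ := exists_curve_through_subseq
    (hconv.comp hψ.tendsto_atTop) ((continuous_snd.tendsto _).comp hlim)
  have hxlim : Tendsto (fun n => x (ψ (σ n))) atTop (𝓝 p) :=
    ht.1.2.1.comp (hψ.comp hσ).tendsto_atTop
  have hk : Tendsto (fun n => k (ψ (σ n))) atTop (𝓝 ℓ) :=
    (hΓ.preimage f hf.2 (hφ p)).tendsto_tangent
      (fun n => TangentAt.preimage f hf.2 (hφ _) (hΓx n)) hxlim
  exact ht.2 (ψ ∘ σ) (hψ.comp hσ) (hxlim.prodMk_nhds hk)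
end
end
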